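/- Let n > 1 be an odd positive integer. Then ∑_{k=0}^{n−1} (q^{−1};q^2)_k^2 · q^{2k} / (q^2;q^2)_k^2 ≡ 0 (mod [n]·Φ_n(q)), as rational functions of q over ℚ, where [n] = 1 + q + ⋯ + q^{n−1}. -/

import Mathlib

open Finset Polynomial

/-- The q-shifted factorial `(x; q)_k = ∏_{j=0}^{k-1} (1 - x q^j)` in `RatFunc ℚ`. -/
noncomputable def qPoch (x q : RatFunc ℚ) (k : ℕ) : RatFunc ℚ :=
  ∏ j ∈ Finset.range k, (1 - x * q ^ j)

/-- `A ≡ 0 (mod P)`: `A = P · B` for some rational function `B` whose denominator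
(in lowest terms) is coprime to `P`. -/
def CongrZero (A : RatFunc ℚ) (P : Polynomial ℚ) : Prop :=
  ∃ B : RatFunc ℚ, A = algebraMap (Polynomial ℚ) (RatFunc ℚ) P * B ∧ IsCoprime B.denom P

/-- The product `(1 - X)(1 - X^2)⋯(1 - X^m)`. -/
noncomputable def qFac (m : ℕ) : ℚ[X] := ∏ j ∈ range m, (1 - X ^ (j + 1))

/-- The product `(1 + X)(1 + X^2)⋯(1 + X^m)`. -/
noncomputable def qFacNeg (m : ℕ) : ℚ[X] := ∏ j ∈ range m, (1 + X ^ (j + 1))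

lemma qFac_succ (m : ℕ) : qFac (m + 1) = qFac m * (1 - X ^ (m + 1)) :=
  prod_range_succ _ _

lemma one_sub_X_pow_ne_zero (j : ℕ) : (1 - X ^ (j + 1) : ℚ[X]) ≠ 0 := by
  rw [← neg_ne_zero, neg_sub]
  exact X_pow_sub_C_ne_zero j.succ_pos (1 : ℚ)

lemma qFac_ne_zero (m : ℕ) : qFac m ≠ 0 :=
  prod_ne_zero_iff.mpr fun j _ => one_sub_X_pow_ne_zero j

lemma qFac_mul_qFac_dvd (a b : ℕ) : qFac a * qFac b ∣ qFac (a + b) := by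
  induction a generalizing b with
  | zero => simp [qFac]
  | succ a iha =>
    induction b with
    | zero => simp [qFac]
    | succ b ihb =>
      obtain ⟨c, hc⟩ := iha (b + 1)
      obtain ⟨d, hd⟩ := ihb
      refine ⟨c + X ^ (a + 1) * d, ?_⟩
      have e : a + 1 + b = a + (b + 1) := by ring
      rw [e] at hd
      rw [show a + 1 + (b + 1) = a + (b + 1) + 1 by ring, qFac_succ (a + (b + 1))]
      calc qFac (a + (b + 1)) * (1 - X ^ (a + (b + 1) + 1))
          = qFac (a + (b + 1)) * (1 - X ^ (a + 1))
            + qFac (a + (b + 1)) * (X ^ (a + 1) * (1 - X ^ (b + 1))) := by ring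
        _ = qFac a * qFac (b + 1) * c * (1 - X ^ (a + 1))
            + qFac (a + 1) * qFac b * d * (X ^ (a + 1) * (1 - X ^ (b + 1))) := by
          rw [← hd, hc]
        _ = _ := by rw [qFac_succ a, qFac_succ b]; ring

lemma isCoprime_geom_two_mul_add_one (m : ℕ) :
    IsCoprime (∑ i ∈ range (m + 1), X ^ i : ℚ[X]) (∑ i ∈ range (2 * m + 1), X ^ i) := by
  have h : IsCoprime (∑ i ∈ range (m + 1), X ^ i : ℚ[X]) (X ^ (2 * m + 1)) := by
    refine IsCoprime.pow_right ⟨1, -∑ i ∈ range m, X ^ i, ?_⟩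
    rw [geom_sum_succ]
    ring
  have e : (∑ i ∈ range (2 * m + 1), X ^ i : ℚ[X])
      = -X ^ (2 * m + 1) + (∑ i ∈ range (m + 1), X ^ i) * (1 + X ^ (m + 1)) := by
    have h1 := sum_range_succ (fun i => (X : ℚ[X]) ^ i) (2 * m + 1)
    have h2 := sum_range_add (fun i => (X : ℚ[X]) ^ i) (m + 1) (m + 1)
    rw [show 2 * m + 1 + 1 = m + 1 + (m + 1) by ring, h2] at h1
    simp only [pow_add _ (m + 1), ← mul_sum] at h1
    linear_combination -h1
  rw [e]
  exact h.neg_right.add_mul_left_right _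

lemma exists_qFac_two_mul_eq (m : ℕ) :
    ∃ c, qFac (2 * m) = qFac m ^ 2 * ((∑ i ∈ range (m + 1), X ^ i) * c) := by
  obtain ⟨c, hc⟩ := qFac_mul_qFac_dvd m m
  obtain ⟨e, he⟩ := qFac_mul_qFac_dvd (m + 1) m
  rw [← two_mul] at hc
  rw [show m + 1 + m = 2 * m + 1 by ring, qFac_succ, qFac_succ, hc] at he
  have hne : qFac m * qFac m * (1 - X) ≠ 0 :=
    mul_ne_zero (mul_ne_zero (qFac_ne_zero m) (qFac_ne_zero m))
      (by simpa using one_sub_X_pow_ne_zero 0)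
  have key : c * (∑ i ∈ range (2 * m + 1), X ^ i) = (∑ i ∈ range (m + 1), X ^ i) * e := by
    apply mul_left_cancel₀ hne
    rw [← mul_neg_geom_sum X (2 * m + 1), ← mul_neg_geom_sum X (m + 1)] at he
    linear_combination he
  obtain ⟨d, rfl⟩ := (isCoprime_geom_two_mul_add_one m).dvd_of_dvd_mul_right ⟨e, key⟩
  exact ⟨d, by rw [hc, sq]⟩

lemma isCoprime_qFacNeg_geom {n : ℕ} (hodd : Odd n) (m : ℕ) :
    IsCoprime (qFacNeg m) (∑ i ∈ range n, X ^ i : ℚ[X]) := by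
  refine IsCoprime.prod_left fun j _ => ?_
  obtain ⟨a, ha⟩ := hodd.add_dvd_pow_add_pow (1 : ℚ[X]) (X ^ (j + 1))
  have hb : (∑ i ∈ range n, X ^ i : ℚ[X]) ∣ X ^ ((j + 1) * n) - 1 := by
    rw [mul_comm, pow_mul]
    exact (Dvd.intro _ (geom_sum_mul X n)).trans (sub_one_dvd_pow_sub_one _ _)
  obtain ⟨b, hb⟩ := hb
  refine ⟨C (1 / 2) * a, -C (1 / 2) * b, ?_⟩
  have h2 : (C (1 / 2) * 2 : ℚ[X]) = 1 := by
    rw [← C_ofNat, ← C_mul]; norm_num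
  rw [one_pow, ← pow_mul] at ha
  linear_combination (-C (1 / 2)) * ha + C (1 / 2) * hb + h2

section RatFunc

local notation "q" => (RatFunc.X : RatFunc ℚ)

lemma ratFunc_one_sub_X_pow_ne_zero (j : ℕ) : (1 - q ^ (j + 1)) ≠ 0 := by
  have h := (map_ne_zero_iff _ (RatFunc.algebraMap_injective ℚ)).mpr (one_sub_X_pow_ne_zero j)
  simpa [RatFunc.algebraMap_X] using h

lemma qPoch_sq_ne_zero (k : ℕ) : qPoch (q ^ 2) (q ^ 2) k ≠ 0 := by
  refine prod_ne_zero_iff.mpr fun j _ => ?_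
  rw [show q ^ 2 * (q ^ 2) ^ j = q ^ (2 * j + 1 + 1) by ring]
  exact ratFunc_one_sub_X_pow_ne_zero _

lemma qPoch_succ (x y : RatFunc ℚ) (k : ℕ) :
    qPoch x y (k + 1) = qPoch x y k * (1 - x * y ^ k) :=
  prod_range_succ _ _

lemma qPoch_inv_succ (k : ℕ) :
    qPoch (q ^ (-1 : ℤ)) (q ^ 2) (k + 1) = (1 - q⁻¹) * qPoch q (q ^ 2) k := by
  rw [qPoch, prod_range_succ', mul_comm, qPoch]
  simp only [zpow_neg_one, pow_zero, mul_one]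
  congr 1
  refine prod_congr rfl fun j _ => ?_
  have := RatFunc.X_ne_zero (K := ℚ)
  field_simp
  ring

/-- Closed form of the truncated series. -/
lemma sum_qPoch_eq (m : ℕ) :
    ∑ k ∈ range (m + 1), (qPoch (q ^ (-1 : ℤ)) (q ^ 2) k) ^ 2 * q ^ (2 * k)
        / (qPoch (q ^ 2) (q ^ 2) k) ^ 2
      = (qPoch q (q ^ 2) m / qPoch (q ^ 2) (q ^ 2) m) ^ 2
        * (q ^ (2 * m) + 2 * ∑ i ∈ range (2 * m), q ^ i) := by
  induction m with
  | zero => simp [qPoch]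
  | succ m ih =>
    have h0 := RatFunc.X_ne_zero (K := ℚ)
    have h1 : 1 - q ≠ 0 := by simpa using ratFunc_one_sub_X_pow_ne_zero 0
    have h2 := qPoch_sq_ne_zero m
    have h3 : 1 - q ^ 2 * (q ^ 2) ^ m ≠ 0 := by
      rw [show q ^ 2 * (q ^ 2) ^ m = q ^ (2 * m + 1 + 1) by ring]
      exact ratFunc_one_sub_X_pow_ne_zero _
    have hg (k : ℕ) : ∑ i ∈ range k, q ^ i = (1 - q ^ k) / (1 - q) := by
      rw [eq_div_iff h1, geom_sum_mul_neg]
    rw [sum_range_succ, ih, qPoch_inv_succ, qPoch_succ, qPoch_succ, hg, hg,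
      show q ^ (2 * (m + 1)) = q ^ 2 * (q ^ 2) ^ m by ring, pow_mul]
    generalize (q ^ 2) ^ m = y at *
    field_simp
    ring

lemma qPoch_mul_qPoch (m : ℕ) :
    qPoch q (q ^ 2) m * qPoch (q ^ 2) (q ^ 2) m = algebraMap ℚ[X] _ (qFac (2 * m)) := by
  induction m with
  | zero => simp [qPoch, qFac]
  | succ m ih =>
    rw [mul_add_one, qFac_succ, qFac_succ, map_mul, map_mul, ← ih, qPoch_succ, qPoch_succ]
    simp only [map_sub, map_one, map_pow, RatFunc.algebraMap_X]
    ring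

lemma qPoch_sq_eq (m : ℕ) :
    qPoch (q ^ 2) (q ^ 2) m = algebraMap ℚ[X] _ (qFac m * qFacNeg m) := by
  rw [qFac, qFacNeg, ← prod_mul_distrib, map_prod, qPoch]
  refine prod_congr rfl fun j _ => ?_
  simp only [map_mul, map_add, map_sub, map_one, map_pow, RatFunc.algebraMap_X]
  ring

end RatFunc

theorem stmt3 (n : ℕ) (hn : 1 < n) (hodd : Odd n) :
    CongrZero
      (∑ k ∈ Finset.range n,
        (qPoch ((RatFunc.X : RatFunc ℚ) ^ (-1 : ℤ)) (RatFunc.X ^ 2) k) ^ 2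
            * RatFunc.X ^ (2 * k)
          / (qPoch ((RatFunc.X : RatFunc ℚ) ^ 2) (RatFunc.X ^ 2) k) ^ 2)
      ((∑ i ∈ Finset.range n, (Polynomial.X : Polynomial ℚ) ^ i)
        * Polynomial.cyclotomic n ℚ) := by
  obtain ⟨m, rfl⟩ : ∃ m, n = m + 1 := ⟨n - 1, by omega⟩
  obtain ⟨c, hc⟩ := exists_qFac_two_mul_eq m
  have hcyc : cyclotomic (m + 1) ℚ ∣ ∑ i ∈ range (m + 1), X ^ i :=
    cyclotomic_dvd_geom_sum_of_dvd ℚ dvd_rfl hn.ne'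
  have hcop := isCoprime_qFacNeg_geom hodd m
  obtain ⟨d, hd⟩ := id hcyc
  have hne : qPoch (RatFunc.X ^ 2) (RatFunc.X ^ 2) m ≠ 0 := qPoch_sq_ne_zero m
  have hw := qPoch_mul_qPoch m
  rw [hc] at hw
  rw [qPoch_sq_eq, map_mul] at hne
  obtain ⟨hA, hB⟩ := mul_ne_zero_iff.mp hne
  rw [qPoch_sq_eq, map_mul, ← eq_div_iff hne] at hw
  refine ⟨algebraMap ℚ[X] _ (d * c ^ 2 * (X ^ (2 * m) + 2 * ∑ i ∈ range (2 * m), X ^ i))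
    / algebraMap ℚ[X] _ (qFacNeg m ^ 4), ?_, ?_⟩
  · have hd' := congrArg (algebraMap ℚ[X] (RatFunc ℚ)) hd
    rw [map_mul] at hd'
    rw [sum_qPoch_eq, hw, qPoch_sq_eq]
    simp only [map_mul, map_add, map_pow, map_sum, RatFunc.algebraMap_X, map_ofNat] at hd' ⊢
    field_simp
    linear_combination (∑ i ∈ range (m + 1), RatFunc.X ^ i) * algebraMap ℚ[X] _ c ^ 2
      * (RatFunc.X ^ (2 * m) + 2 * ∑ i ∈ range (2 * m), RatFunc.X ^ i) * hd'
  · refine IsCoprime.of_isCoprime_of_dvd_left ?_ (RatFunc.denom_div_dvd _ _)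
    exact (hcop.mul_right (hcop.of_isCoprime_of_dvd_right hcyc)).pow_left
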